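/- Additive linear logic is safe for the majority rule: for every agenda Φ of ALL formulas, every odd number n ≥ 3 of agents, and every profile (J_1,…,J_n) of robustly consistent and complete judgment sets over Φ, the majority outcome M(J) is robustly consistent in ALL. -/

import Mathlib

namespace Stmt13

/-- Formulas of additive linear logic (ALL): atoms, linear negation, & and ⊕, no units. -/
inductive AForm : Type
  | atom  : ℕ → AForm
  | neg   : AForm → AForm
  | awith : AForm → AForm → AForm         -- &
  | aplus : AForm → AForm → AForm         -- ⊕
  deriving DecidableEq

/-- Two-sided sequent calculus for ALL on multisets (no weakening, no contraction). -/
inductive ADeriv : Multiset AForm → Multiset AForm → Prop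
  | ax (A) : ADeriv {A} {A}
  | cut {Γ Δ Γ' Δ' A} : ADeriv (A ::ₘ Γ) Δ → ADeriv Γ' (A ::ₘ Δ') →
      ADeriv (Γ + Γ') (Δ + Δ')
  | negL {Γ Δ A} : ADeriv Γ (A ::ₘ Δ) → ADeriv (AForm.neg A ::ₘ Γ) Δ
  | negR {Γ Δ A} : ADeriv (A ::ₘ Γ) Δ → ADeriv Γ (AForm.neg A ::ₘ Δ)
  | withR {Γ Δ A B} : ADeriv Γ (A ::ₘ Δ) → ADeriv Γ (B ::ₘ Δ) →
      ADeriv Γ (AForm.awith A B ::ₘ Δ)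
  | withL1 {Γ Δ A B} : ADeriv (A ::ₘ Γ) Δ → ADeriv (AForm.awith A B ::ₘ Γ) Δ
  | withL2 {Γ Δ A B} : ADeriv (B ::ₘ Γ) Δ → ADeriv (AForm.awith A B ::ₘ Γ) Δ
  | plusL {Γ Δ A B} : ADeriv (A ::ₘ Γ) Δ → ADeriv (B ::ₘ Γ) Δ →
      ADeriv (AForm.aplus A B ::ₘ Γ) Δ
  | plusR1 {Γ Δ A B} : ADeriv Γ (A ::ₘ Δ) → ADeriv Γ (AForm.aplus A B ::ₘ Δ)
  | plusR2 {Γ Δ A B} : ADeriv Γ (B ::ₘ Δ) → ADeriv Γ (AForm.aplus A B ::ₘ Δ)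

/-- ALL-inconsistency: Γ ⊢ (empty succedent) is derivable. -/
def AInconsistent (Γ : Multiset AForm) : Prop := ADeriv Γ 0

/-- Robust consistency in ALL: every submultiset is ALL-consistent. -/
def robustlyConsistent (Γ : Multiset AForm) : Prop :=
  ∀ Δ : Multiset AForm, Δ ≤ Γ → ¬ AInconsistent Δ

/-- The complement ∼φ. -/
def AForm.compl : AForm → AForm
  | .neg ψ => ψ
  | φ      => .neg φ

def completeOn (Φ J : Finset AForm) : Prop := ∀ φ ∈ Φ, φ ∈ J ∨ φ.compl ∈ J

def complementFree (J : Finset AForm) : Prop := ∀ φ ∈ J, φ.compl ∉ J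

def nsupp (n : ℕ) (J : Fin n → Finset AForm) (φ : AForm) : ℕ :=
  (Finset.univ.filter (fun i => φ ∈ J i)).card

/-- The majority rule. -/
def maj (n : ℕ) (Φ : Finset AForm) (J : Fin n → Finset AForm) : Finset AForm :=
  Φ.filter (fun φ => n < 2 * nsupp n J φ)

def isTautology (φ : AForm) : Prop := ADeriv 0 {φ}
def isContradiction (φ : AForm) : Prop := ADeriv {φ} 0

/-- An ALL agenda: finite, closed under complement, no tautologies or contradictions. -/
def isAgenda (Φ : Finset AForm) : Prop :=
  (∀ φ ∈ Φ, φ.compl ∈ Φ) ∧ ∀ φ ∈ Φ, ¬ isTautology φ ∧ ¬ isContradiction φ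

/-- Every derivable sequent contains exactly two formula occurrences. -/
theorem ADeriv.card_eq_two {Γ Δ : Multiset AForm} (h : ADeriv Γ Δ) :
    Multiset.card Γ + Multiset.card Δ = 2 := by
  induction h <;> simp only [Multiset.card_cons, Multiset.card_add, Multiset.card_singleton] at * <;>
    omega

/-- additive linear logic is safe for the majority rule: for every ALL
agenda Φ, every odd n ≥ 3, and every profile of robustly consistent and complete
judgment sets over Φ, the majority outcome is robustly consistent in ALL. -/
theorem all_safe_for_majority
    (Φ : Finset AForm) (hΦ : isAgenda Φ)
    (n : ℕ) (hodd : Odd n) (h3 : 3 ≤ n)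
    (J : Fin n → Finset AForm)
    (hJ : ∀ i, J i ⊆ Φ ∧ robustlyConsistent (J i).val ∧ completeOn Φ (J i)) :
    robustlyConsistent (maj n Φ J).val := by
  intro Δ hΔ hinc
  have hc : Multiset.card Δ = 2 := by
    have := ADeriv.card_eq_two hinc
    simpa using this
  have hnd : Δ.Nodup := Multiset.nodup_of_le hΔ (maj n Φ J).nodup
  obtain ⟨A, B, rfl⟩ := Multiset.card_eq_two.mp hc
  have hA : A ∈ maj n Φ J := Multiset.mem_of_le hΔ (by simp)
  have hB : B ∈ maj n Φ J := Multiset.mem_of_le hΔ (by simp)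
  have hA2 := (Finset.mem_filter.mp hA).2
  have hB2 := (Finset.mem_filter.mp hB).2
  unfold nsupp at hA2 hB2
  have hex : ∃ i, A ∈ J i ∧ B ∈ J i := by
    by_contra hno
    have hdisj : Disjoint (Finset.univ.filter (fun i => A ∈ J i))
        (Finset.univ.filter (fun i => B ∈ J i)) := by
      rw [Finset.disjoint_left]
      intro i hi hi'
      exact hno ⟨i, (Finset.mem_filter.mp hi).2, (Finset.mem_filter.mp hi').2⟩
    have h1 := Finset.card_union_of_disjoint hdisj
    have h2 := Finset.card_le_univ (Finset.univ.filter (fun i => A ∈ J i) ∪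
        Finset.univ.filter (fun i => B ∈ J i))
    rw [Fintype.card_fin] at h2
    omega
  obtain ⟨i, hAi, hBi⟩ := hex
  refine (hJ i).2.1 _ ?_ hinc
  rw [Multiset.le_iff_subset hnd]
  intro x hx
  simp only [Multiset.insert_eq_cons, Multiset.mem_cons, Multiset.mem_singleton] at hx
  rcases hx with rfl | rfl
  · exact hAi
  · exact hBi

end Stmt13
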